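/- arXiv:1812.11796 — 2 statements merged into one kernel-verified Lean document; each statement's English description precedes it below -/
import Mathlib

section
/- For the single-sequence SDP with parameter n ≥ 3 and any 1 ≤ i ≤ n−2: a positive semidefinite n×n matrix Y satisfies trace(AⱼY) = 0 for j = 1,…,i if and only if all entries of Y in its first i rows and columns are zero; that is, PSD^n ∩ A₁^⊥ ∩ … ∩ A_i^⊥ = 0_i ⊕ PSD^{n−i}. -/
open Matrix

/-- `Eij n i j` : the `n×n` symmetric matrix whose only nonzero entries are `1`
in positions `(i,j)` and `(j,i)` (0-based indices). -/
def Eij (n i j : ℕ) : Matrix (Fin n) (Fin n) ℝ :=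
  Matrix.of fun a b => if (a.val = i ∧ b.val = j) ∨ (a.val = j ∧ b.val = i) then 1 else 0

/-- The constraint matrices of the single-sequence SDP (0-based index `k`):
`A₁ = E₁` and `Aᵢ = Eᵢ + E_{i-1,n}` for `i = 2, …, n-1` (1-based indices of the paper). -/
def singleA (n : ℕ) : Fin (n - 1) → Matrix (Fin n) (Fin n) ℝ := fun k =>
  if k.val = 0 then Eij n 0 0 else Eij n k.val k.val + Eij n (k.val - 1) (n - 1)

theorem Matrix.PosSemidef.apply_eq_zero_of_diag_eq_zero {ι : Type*} [Fintype ι] [DecidableEq ι]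
    {M : Matrix ι ι ℝ} (hM : M.PosSemidef) {a : ι} (ha : M a a = 0) (b : ι) :
    M a b = 0 ∧ M b a = 0 := by
  have hcol : M *ᵥ Pi.single a 1 = 0 := by
    rw [← hM.dotProduct_mulVec_zero_iff]
    simp [ha]
  have hba : M b a = 0 := by simpa using congrFun hcol b
  exact ⟨by simpa [hba] using (hM.isHermitian.apply a b).symm, hba⟩

theorem Eij_self {n : ℕ} (a : Fin n) : Eij n a a = Matrix.single a a 1 := by
  ext x y
  simp [Eij, Matrix.single_apply, Fin.ext_iff, eq_comm]

theorem Eij_of_ne {n : ℕ} {a b : Fin n} (hab : a ≠ b) :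
    Eij n a b = Matrix.single a b 1 + Matrix.single b a 1 := by
  ext x y
  simp only [Eij, Matrix.of_apply, Matrix.add_apply, Matrix.single_apply, Fin.ext_iff] at hab ⊢
  split_ifs <;> first | omega | simp

theorem trace_Eij_self_mul {n : ℕ} (a : Fin n) (Y : Matrix (Fin n) (Fin n) ℝ) :
    (Eij n a a * Y).trace = Y a a := by
  simp [Eij_self, Matrix.trace_single_mul]

theorem trace_Eij_mul_of_ne {n : ℕ} {a b : Fin n} (hab : a ≠ b) (Y : Matrix (Fin n) (Fin n) ℝ) :
    (Eij n a b * Y).trace = Y b a + Y a b := by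
  simp [Eij_of_ne hab, Matrix.add_mul, Matrix.trace_single_mul]

theorem trace_singleA_zero_mul {n : ℕ} (hn : 0 < n - 1) (Y : Matrix (Fin n) (Fin n) ℝ) :
    (singleA n ⟨0, hn⟩ * Y).trace = Y ⟨0, by omega⟩ ⟨0, by omega⟩ := by
  simpa [singleA] using trace_Eij_self_mul ⟨0, by omega⟩ Y

theorem trace_singleA_succ_mul {n k : ℕ} (hk : k + 1 < n - 1) (Y : Matrix (Fin n) (Fin n) ℝ) :
    (singleA n ⟨k + 1, hk⟩ * Y).trace = Y ⟨k + 1, by omega⟩ ⟨k + 1, by omega⟩ +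
      (Y ⟨n - 1, by omega⟩ ⟨k, by omega⟩ + Y ⟨k, by omega⟩ ⟨n - 1, by omega⟩) := by
  have hne : (⟨k, by omega⟩ : Fin n) ≠ ⟨n - 1, by omega⟩ := by
    simp only [ne_eq, Fin.mk.injEq]
    omega
  rw [← trace_Eij_self_mul ⟨k + 1, by omega⟩ Y, ← trace_Eij_mul_of_ne hne Y]
  simp [singleA, Matrix.add_mul]

/-- For the single-sequence SDP with parameter `n ≥ 3` and any `1 ≤ i ≤ n-2`:
a psd matrix `Y` satisfies `trace(Aⱼ Y) = 0` for `j = 1, …, i` iff all entries of `Y`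
in its first `i` rows and columns are zero; i.e.
`PSDⁿ ∩ A₁^⊥ ∩ … ∩ A_i^⊥ = 0_i ⊕ PSD^{n-i}`. -/
theorem singleSeq_zero_rows {n i : ℕ} (hn : 3 ≤ n) (h1 : 1 ≤ i) (h2 : i ≤ n - 2)
    (Y : Matrix (Fin n) (Fin n) ℝ) (hY : Y.PosSemidef) :
    (∀ k : Fin (n - 1), k.val < i → ((singleA n k) * Y).trace = 0) ↔
    (∀ a b : Fin n, a.val < i → Y a b = 0 ∧ Y b a = 0) := by
  constructor
  · intro h
    have hdiag : ∀ k (hk : k < i), Y ⟨k, by omega⟩ ⟨k, by omega⟩ = 0 := by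
      intro k
      induction k with
      | zero =>
        intro hk
        rw [← trace_singleA_zero_mul (by omega) Y]
        exact h _ hk
      | succ k ih =>
        intro hk
        have htr := h ⟨k + 1, by omega⟩ hk
        obtain ⟨hrow, hcol⟩ := hY.apply_eq_zero_of_diag_eq_zero (ih (by omega)) ⟨n - 1, by omega⟩
        rwa [trace_singleA_succ_mul, hrow, hcol, add_zero, add_zero] at htr
    exact fun a b ha => hY.apply_eq_zero_of_diag_eq_zero (hdiag a ha) b
  · rintro h ⟨_ | k, hk⟩ hki
    · rw [trace_singleA_zero_mul]
      exact (h _ _ hki).1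
    · have hki' : k < i := Nat.lt_of_succ_lt hki
      rw [trace_singleA_succ_mul, (h ⟨k + 1, by omega⟩ _ hki).1, (h ⟨k, by omega⟩ _ hki').1,
        (h ⟨k, by omega⟩ _ hki').2, add_zero, add_zero]
end

section
/- For the double-sequence SDP with parameter m ≥ 2: val(P) = 0 and val(D) = 1, so there is a positive duality gap of exactly 1. -/
open Matrix

/-- The optimal value of the primal SDP (P). -/
noncomputable def valP {n m : ℕ} (A : Fin m → Matrix (Fin n) (Fin n) ℝ)
    (B : Matrix (Fin n) (Fin n) ℝ) (c : Fin m → ℝ) : EReal :=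
  sSup ((fun x : Fin m → ℝ => ((∑ i, c i * x i : ℝ) : EReal)) ''
    {x | (B - ∑ i, x i • A i).PosSemidef})

/-- The optimal value of the dual SDP (D). -/
noncomputable def valD {n m : ℕ} (A : Fin m → Matrix (Fin n) (Fin n) ℝ)
    (B : Matrix (Fin n) (Fin n) ℝ) (c : Fin m → ℝ) : EReal :=
  sInf ((fun Y : Matrix (Fin n) (Fin n) ℝ => (((B * Y).trace : ℝ) : EReal)) ''
    {Y | Y.PosSemidef ∧ ∀ i, ((A i) * Y).trace = c i})

/-- The constraint matrices of the double-sequence SDP with parameter `m`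
(`n = 2m+1`, 0-based index `k`): `A₁ = E₁ + E_{m+1}`,
`Aᵢ = Eᵢ + E_{m+i} + E_{i-1,n} + E_{m+i-1,n}` for `i = 2, …, m-1`, and
`A_m = E_m - E_{2m} + E_{m-1,n} + E_{2m-1,n}` (1-based indices of the paper). -/
def doubleA (m : ℕ) : Fin m → Matrix (Fin (2 * m + 1)) (Fin (2 * m + 1)) ℝ := fun k =>
  if k.val = 0 then Eij (2 * m + 1) 0 0 + Eij (2 * m + 1) m m
  else if k.val = m - 1 then
    Eij (2 * m + 1) (m - 1) (m - 1) - Eij (2 * m + 1) (2 * m - 1) (2 * m - 1) +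
      Eij (2 * m + 1) (m - 2) (2 * m) + Eij (2 * m + 1) (2 * m - 2) (2 * m)
  else
    Eij (2 * m + 1) k.val k.val + Eij (2 * m + 1) (m + k.val) (m + k.val) +
      Eij (2 * m + 1) (k.val - 1) (2 * m) + Eij (2 * m + 1) (m + k.val - 1) (2 * m)

/-- The right hand side of the double-sequence SDP: ones in the first `m+1`
diagonal entries, zeros elsewhere. -/
def doubleB (m : ℕ) : Matrix (Fin (2 * m + 1)) (Fin (2 * m + 1)) ℝ :=
  Matrix.of fun a b => if a = b ∧ a.val < m + 1 then 1 else 0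

/-- The objective vector of the double-sequence SDP: `c = e_m ∈ ℝ^m`. -/
def doubleC (m : ℕ) : Fin m → ℝ := fun k => if k.val = m - 1 then 1 else 0

/-- A positive semidefinite real matrix with a vanishing diagonal entry vanishes on the whole
corresponding row. -/
lemma Matrix.PosSemidef.apply_eq_zero_of_diag_eq_zero_s11 {ι : Type*} {M : Matrix ι ι ℝ}
    (hM : M.PosSemidef) {i : ι} (hi : M i i = 0) (j : ι) : M i j = 0 := by
  have hdet := (hM.submatrix ![i, j]).det_nonneg
  have hsymm : M j i = M i j := by simpa using hM.isHermitian.apply i j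
  simp only [det_fin_two, submatrix_apply, cons_val_zero, cons_val_one, hi, hsymm] at hdet
  nlinarith [sq_nonneg (M i j)]

lemma trace_Eij_diag_mul {n i : ℕ} (hi : i < n) (Y : Matrix (Fin n) (Fin n) ℝ) :
    (Eij n i i * Y).trace = Y ⟨i, hi⟩ ⟨i, hi⟩ := by
  have h : Eij n i i = single ⟨i, hi⟩ ⟨i, hi⟩ 1 := by
    ext a b
    simp [Eij, single, Fin.ext_iff, eq_comm]
  rw [h, trace_single_mul, one_smul]

lemma trace_Eij_mul {n i j : ℕ} (hi : i < n) (hj : j < n) (hij : i ≠ j)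
    (Y : Matrix (Fin n) (Fin n) ℝ) :
    (Eij n i j * Y).trace = Y ⟨j, hj⟩ ⟨i, hi⟩ + Y ⟨i, hi⟩ ⟨j, hj⟩ := by
  have h : Eij n i j = single ⟨i, hi⟩ ⟨j, hj⟩ 1 + single ⟨j, hj⟩ ⟨i, hi⟩ 1 := by
    ext a b
    simp only [Eij, single, of_apply, Matrix.add_apply, Fin.ext_iff]
    split_ifs <;> first | omega | norm_num
  rw [h, Matrix.add_mul, trace_add, trace_single_mul, trace_single_mul, one_smul, one_smul]

lemma doubleA_last_last {m : ℕ} (hm : 2 ≤ m) (k : Fin m) :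
    doubleA m k (Fin.last (2 * m)) (Fin.last (2 * m)) = 0 := by
  have hk := k.isLt
  simp only [doubleA, Eij]
  split_ifs <;> simp only [Matrix.add_apply, Matrix.sub_apply, of_apply, Fin.val_last] <;>
    split_ifs <;> first | omega | norm_num

lemma doubleA_sub_two_last {m : ℕ} (hm : 2 ≤ m) (k : Fin m) :
    doubleA m k ⟨m - 2, by omega⟩ (Fin.last (2 * m)) = doubleC m k := by
  have hk := k.isLt
  simp only [doubleA, doubleC, Eij]
  split_ifs <;> simp only [Matrix.add_apply, Matrix.sub_apply, of_apply, Fin.val_last] <;>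
    split_ifs <;> first | omega | simp_all

lemma doubleA_sub_one_sub_one {m : ℕ} (hm : 2 ≤ m) (k : Fin m) :
    doubleA m k ⟨m - 1, by omega⟩ ⟨m - 1, by omega⟩ = doubleC m k := by
  have hk := k.isLt
  simp only [doubleA, doubleC, Eij]
  split_ifs <;> simp only [Matrix.add_apply, Matrix.sub_apply, of_apply] <;>
    split_ifs <;> first | omega | simp_all

lemma doubleB_eq_diagonal (m : ℕ) :
    doubleB m = diagonal fun a : Fin (2 * m + 1) => if a.val < m + 1 then 1 else 0 := by
  ext a b
  simp only [doubleB, diagonal_apply, of_apply, ite_and]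

lemma posSemidef_doubleB (m : ℕ) : (doubleB m).PosSemidef := by
  rw [doubleB_eq_diagonal]
  refine PosSemidef.diagonal fun a => ?_
  dsimp only [Pi.zero_apply]
  split_ifs <;> norm_num

lemma trace_doubleB_mul (m : ℕ) (Y : Matrix (Fin (2 * m + 1)) (Fin (2 * m + 1)) ℝ) :
    (doubleB m * Y).trace = ∑ a, if a.val < m + 1 then Y a a else 0 := by
  simp [doubleB_eq_diagonal, trace, diagonal_mul]

/-- Every primal feasible point has objective value zero. -/
lemma primal_objective_eq_zero {m : ℕ} (hm : 2 ≤ m) {x : Fin m → ℝ}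
    (hx : (doubleB m - ∑ i, x i • doubleA m i).PosSemidef) : ∑ i, doubleC m i * x i = 0 := by
  have hsymm := hx.isHermitian.apply ⟨m - 2, by omega⟩ (Fin.last (2 * m))
  have hcorner : (doubleB m - ∑ i, x i • doubleA m i) (Fin.last (2 * m)) (Fin.last (2 * m)) = 0 := by
    have hlt : m < 2 * m := by omega
    simp [Matrix.sub_apply, Matrix.sum_apply, doubleA_last_last hm, doubleB, hlt]
  have hzero := hx.apply_eq_zero_of_diag_eq_zero_s11 hcorner ⟨m - 2, by omega⟩
  rw [hzero, star_zero] at hsymm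
  have hne : (⟨m - 2, by omega⟩ : Fin (2 * m + 1)) ≠ Fin.last (2 * m) := by
    rw [Ne, Fin.ext_iff, Fin.val_last]
    dsimp only
    omega
  simp only [Matrix.sub_apply, Matrix.sum_apply, Matrix.smul_apply, doubleA_sub_two_last hm,
    doubleB, of_apply, hne, false_and, if_false, smul_eq_mul, zero_sub] at hsymm
  simp only [mul_comm (doubleC m _)]
  linarith

/-- The constraints of the dual force the diagonal entries of both sequences to vanish, except
for the last ones. -/
lemma dual_diag_eq_zero {m : ℕ} {Y : Matrix (Fin (2 * m + 1)) (Fin (2 * m + 1)) ℝ}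
    (hY : Y.PosSemidef) (hA : ∀ i, (doubleA m i * Y).trace = doubleC m i) (k : ℕ)
    (hk : k + 1 < m) :
    Y ⟨k, by omega⟩ ⟨k, by omega⟩ = 0 ∧ Y ⟨m + k, by omega⟩ ⟨m + k, by omega⟩ = 0 := by
  have hpos := fun i => hY.diag_nonneg (i := i)
  induction k with
  | zero =>
    have h := hA ⟨0, by omega⟩
    have hne : ¬ 0 = m - 1 := by omega
    simp only [doubleA, doubleC, if_true, if_neg hne, Matrix.add_mul, trace_add] at h
    rw [trace_Eij_diag_mul (by omega), trace_Eij_diag_mul (by omega)] at h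
    exact (add_eq_zero_iff_of_nonneg (hpos _) (hpos _)).1 h
  | succ k ih =>
    obtain ⟨h₁, h₂⟩ := ih (by omega)
    have h := hA ⟨k + 1, by omega⟩
    have hne : ¬ k + 1 = m - 1 := by omega
    simp only [doubleA, doubleC, Nat.add_eq_zero_iff, one_ne_zero, and_false, if_false,
      if_neg hne, Matrix.add_mul, trace_add, Nat.add_sub_cancel, ← Nat.add_assoc] at h
    rw [trace_Eij_diag_mul (by omega), trace_Eij_diag_mul (by omega),
      trace_Eij_mul (by omega) (by omega) (by omega),
      trace_Eij_mul (by omega) (by omega) (by omega)] at h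
    have hrow := fun {i} (hi : Y i i = 0) j => hY.apply_eq_zero_of_diag_eq_zero_s11 hi j
    have hcol : ∀ {i} (_ : Y i i = 0) j, Y j i = 0 := fun {i} hi j => by
      rw [← hY.isHermitian.apply, hrow hi, star_zero]
    rw [hrow h₁, hrow h₂, hcol h₁, hcol h₂] at h
    simp only [add_zero] at h
    exact (add_eq_zero_iff_of_nonneg (hpos _) (hpos _)).1 h

/-- Every dual feasible point has objective value at least one. -/
lemma one_le_dual_objective {m : ℕ} (hm : 2 ≤ m)
    {Y : Matrix (Fin (2 * m + 1)) (Fin (2 * m + 1)) ℝ} (hY : Y.PosSemidef)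
    (hA : ∀ i, (doubleA m i * Y).trace = doubleC m i) : 1 ≤ (doubleB m * Y).trace := by
  have hpos := fun i => hY.diag_nonneg (i := i)
  obtain ⟨h₁, h₂⟩ := dual_diag_eq_zero hY hA (m - 2) (by omega)
  have h := hA ⟨m - 1, by omega⟩
  have hne : ¬ m - 1 = 0 := by omega
  simp only [doubleA, doubleC, if_neg hne, if_true, Matrix.add_mul, Matrix.sub_mul, trace_add,
    trace_sub] at h
  rw [trace_Eij_diag_mul (by omega), trace_Eij_diag_mul (by omega),
    trace_Eij_mul (by omega) (by omega) (by omega),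
    trace_Eij_mul (by omega) (by omega) (by omega)] at h
  have hrow := fun {i} (hi : Y i i = 0) j => hY.apply_eq_zero_of_diag_eq_zero_s11 hi j
  have hcol : ∀ {i} (_ : Y i i = 0) j, Y j i = 0 := fun {i} hi j => by
    rw [← hY.isHermitian.apply, hrow hi, star_zero]
  have hidx : (⟨2 * m - 2, by omega⟩ : Fin (2 * m + 1)) = ⟨m + (m - 2), by omega⟩ := by
    rw [Fin.mk.injEq]
    omega
  rw [hidx, hrow h₁, hrow h₂, hcol h₁, hcol h₂] at h
  have hle : Y ⟨m - 1, by omega⟩ ⟨m - 1, by omega⟩ ≤ (doubleB m * Y).trace := by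
    rw [trace_doubleB_mul]
    have := Finset.single_le_sum (s := Finset.univ)
      (f := fun a : Fin (2 * m + 1) => if a.val < m + 1 then Y a a else 0)
      (fun a _ => by
        split_ifs
        exacts [hpos a, le_rfl]) (Finset.mem_univ ⟨m - 1, by omega⟩)
    have hlt : m - 1 < m + 1 := by omega
    simpa only [if_pos hlt] using this
  linarith [hpos ⟨2 * m - 1, by omega⟩]

/-- The matrix `E_m` is dual feasible with objective value one. -/
lemma exists_dual_feasible {m : ℕ} (hm : 2 ≤ m) :
    ∃ Y : Matrix (Fin (2 * m + 1)) (Fin (2 * m + 1)) ℝ, Y.PosSemidef ∧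
      (∀ i, (doubleA m i * Y).trace = doubleC m i) ∧ (doubleB m * Y).trace = 1 := by
  refine ⟨diagonal (Pi.single ⟨m - 1, by omega⟩ 1),
    PosSemidef.diagonal (Pi.single_nonneg.2 zero_le_one), fun i => ?_, ?_⟩
  · rw [diagonal_single, trace_mul_single, doubleA_sub_one_sub_one hm]
    simp
  · rw [diagonal_single, trace_mul_single]
    simp [doubleB]

/-- For the double-sequence SDP with parameter `m ≥ 2`, `val(P) = 0` and
`val(D) = 1`: there is a positive duality gap of exactly `1`. -/
theorem doubleSeq_gap {m : ℕ} (hm : 2 ≤ m) :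
    valP (doubleA m) (doubleB m) (doubleC m) = 0 ∧
    valD (doubleA m) (doubleB m) (doubleC m) = 1 := by
  constructor
  · refine IsGreatest.csSup_eq ⟨⟨0, ?_, by simp⟩, ?_⟩
    · simpa using posSemidef_doubleB m
    · rintro _ ⟨x, hx, rfl⟩
      simp [primal_objective_eq_zero hm hx]
  · refine IsLeast.csInf_eq ⟨?_, ?_⟩
    · obtain ⟨Y, hY, hA, hB⟩ := exists_dual_feasible hm
      exact ⟨Y, ⟨hY, hA⟩, by simp [hB]⟩
    · rintro _ ⟨Y, ⟨hY, hA⟩, rfl⟩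
      exact EReal.coe_le_coe_iff.2 (one_le_dual_objective hm hY hA)
end
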